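/- arXiv:2009.02767 — 4 statements merged into one kernel-verified Lean document; each statement's English description precedes it below -/
import Mathlib

section
/- Let H' be a nondegenerate hermitian lattice over 𝔼 of rank 2 whose induced hermitian form on H' ⊗_𝔼 ℂ has signature (1,1), and suppose the discriminant group D(H') is isomorphic, as a finite 𝔼-module with K/𝔼-valued hermitian form, to V = (𝔼/θ𝔼)² with form ((a₁,a₂),(b₁,b₂)) = (a₁·conj(b₂) − a₂·conj(b₁))·θ/3 (mod 𝔼). Then H' is isometric to the lattice H, i.e. there is an 𝔼-module isomorphism H' → 𝔼² carrying the form of H' to the form with Gram matrix [[0, θ],[−θ, 0]]. -/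
/- STATEMENT 2: Let H' be a nondegenerate rank-2 hermitian lattice over 𝔼
(presented by its Gram matrix B in some basis, so H' = 𝔼² with form
(x,y) = Σᵢⱼ xᵢ·Bᵢⱼ·conj(yⱼ)) whose induced form on H'⊗ℂ has signature (1,1),
and whose discriminant group D(H') is isomorphic, as a finite 𝔼-module with
K/𝔼-valued hermitian form, to V = (𝔼/θ𝔼)² with form
((a₁,a₂),(b₁,b₂)) = (a₁·conj(b₂) − a₂·conj(b₁))·θ/3 mod 𝔼 (an isomorphism of
finite hermitian spaces is encoded at the level of representatives by a map φ
from the dual lattice to 𝔼² which is additive and 𝔼-semilinear mod θ𝔼, kills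
exactly the lattice, is surjective mod θ𝔼, and matches the forms mod 𝔼).
Then H' is isometric to H: there is an 𝔼-module isomorphism of 𝔼² (an 𝔼-invertible
matrix P) carrying the form B to the form with Gram matrix J = [[0,θ],[−θ,0]]. -/

noncomputable section

open Complex Matrix BigOperators

def ω : ℂ := Complex.exp (2 * Real.pi * Complex.I / 3)
def θ : ℂ := ω - ω ^ 2
def Eis : Set ℂ := {z : ℂ | ∃ a b : ℤ, z = (a : ℂ) + (b : ℂ) * ω}
def thetaE : Set ℂ := {z : ℂ | ∃ w ∈ Eis, z = θ * w}

def Jmat : Matrix (Fin 2) (Fin 2) ℂ := !![0, θ; -θ, 0]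

/-- The hermitian form on ℂ² with Gram matrix B. -/
def hermB (B : Matrix (Fin 2) (Fin 2) ℂ) (x y : Fin 2 → ℂ) : ℂ :=
  ∑ i, ∑ j, x i * B i j * star (y j)

/-- The lattice 𝔼² ⊂ ℂ². -/
def E2lat : Set (Fin 2 → ℂ) := {v | ∀ i, v i ∈ Eis}

/-- The dual lattice of (𝔼², B). -/
def dualB (B : Matrix (Fin 2) (Fin 2) ℂ) : Set (Fin 2 → ℂ) :=
  {v | ∀ w ∈ E2lat, hermB B v w ∈ Eis}

lemma omega_eq : ω = -1 / 2 + (Real.sqrt 3 / 2 : ℝ) * Complex.I := by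
  have h : (2 * Real.pi * Complex.I / 3 : ℂ) = ((Real.pi - Real.pi / 3 : ℝ) : ℂ) * Complex.I := by
    push_cast; ring
  rw [ω, h, Complex.exp_mul_I, ← Complex.ofReal_cos, ← Complex.ofReal_sin, Real.cos_pi_sub,
    Real.sin_pi_sub, Real.cos_pi_div_three, Real.sin_pi_div_three]
  push_cast; ring

lemma omega_sq : ω ^ 2 = -1 - ω := by
  have h : ((Real.sqrt 3 : ℝ) : ℂ) ^ 2 = 3 := by
    rw [← Complex.ofReal_pow, Real.sq_sqrt (by norm_num)]; norm_num
  rw [omega_eq]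
  push_cast
  linear_combination (1 / 4 : ℂ) * h * Complex.I ^ 2 + (3 / 4 : ℂ) * Complex.I_sq

lemma conj_omega : (starRingEnd ℂ) ω = -1 - ω := by
  rw [omega_eq]
  simp only [map_add, map_mul, map_div₀, map_neg, map_one, map_ofNat, Complex.conj_ofReal,
    Complex.conj_I]
  ring

lemma theta_eq : θ = 1 + 2 * ω := by
  rw [θ, omega_sq]; ring

lemma omega_im_pos : 0 < ω.im := by
  rw [omega_eq]; simp

/-- `1` and `ω` are linearly independent over `ℤ`. -/
lemma intCast_add_mul_omega_inj {a b c d : ℤ} (h : (a : ℂ) + b * ω = c + d * ω) :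
    a = c ∧ b = d := by
  have him := congrArg Complex.im h
  simp only [Complex.add_im, Complex.intCast_im, Complex.mul_im, Complex.intCast_re,
    zero_mul, add_zero, zero_add] at him
  have hb : (b : ℝ) = d := mul_right_cancel₀ omega_im_pos.ne' him
  have hb' : b = d := by exact_mod_cast hb
  subst hb'
  exact ⟨by exact_mod_cast add_right_cancel h, rfl⟩

lemma intCast_mem_Eis (n : ℤ) : (n : ℂ) ∈ Eis := ⟨n, 0, by simp⟩

lemma zero_mem_Eis : (0 : ℂ) ∈ Eis := ⟨0, 0, by simp⟩

lemma one_mem_Eis : (1 : ℂ) ∈ Eis := ⟨1, 0, by simp⟩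

lemma eis_add {x y : ℂ} (hx : x ∈ Eis) (hy : y ∈ Eis) : x + y ∈ Eis := by
  obtain ⟨a, b, rfl⟩ := hx
  obtain ⟨c, d, rfl⟩ := hy
  exact ⟨a + c, b + d, by push_cast; ring⟩

lemma eis_neg {x : ℂ} (hx : x ∈ Eis) : -x ∈ Eis := by
  obtain ⟨a, b, rfl⟩ := hx
  exact ⟨-a, -b, by push_cast; ring⟩

lemma eis_mul {x y : ℂ} (hx : x ∈ Eis) (hy : y ∈ Eis) : x * y ∈ Eis := by
  obtain ⟨a, b, rfl⟩ := hx
  obtain ⟨c, d, rfl⟩ := hy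
  exact ⟨a * c - b * d, a * d + b * c - b * d, by
    push_cast; linear_combination (b * d : ℂ) * omega_sq⟩

lemma eis_conj {x : ℂ} (hx : x ∈ Eis) : (starRingEnd ℂ) x ∈ Eis := by
  obtain ⟨a, b, rfl⟩ := hx
  refine ⟨a - b, -b, ?_⟩
  simp only [map_add, map_mul, map_intCast, conj_omega]
  push_cast; ring

lemma theta_mem_Eis : θ ∈ Eis := ⟨1, 2, by rw [theta_eq]; norm_num⟩

/-- `θ(a + bω) = (a - 2b) + (2a - b)ω`. -/
lemma theta_mul (a b : ℤ) :
    θ * ((a : ℂ) + b * ω) = ((a - 2 * b : ℤ) : ℂ) + ((2 * a - b : ℤ) : ℂ) * ω := by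
  rw [theta_eq]; push_cast
  linear_combination (2 * b : ℂ) * omega_sq

lemma one_notMem_thetaE : (1 : ℂ) ∉ thetaE := by
  rintro ⟨w, ⟨a, b, rfl⟩, h⟩
  rw [theta_mul] at h
  have := intCast_add_mul_omega_inj (a := 1) (b := 0) (by
    simpa only [Int.cast_one, Int.cast_zero, zero_mul, add_zero] using h)
  omega

lemma thetaE_sub {x y : ℂ} (hx : x ∈ thetaE) (hy : y ∈ thetaE) : x - y ∈ thetaE := by
  obtain ⟨a, ha, rfl⟩ := hx
  obtain ⟨b, hb, rfl⟩ := hy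
  exact ⟨a + -b, eis_add ha (eis_neg hb), by ring⟩

lemma exists_int_of_conj_eq {x : ℂ} (hx : x ∈ Eis) (h : (starRingEnd ℂ) x = x) :
    ∃ n : ℤ, x = n := by
  obtain ⟨a, b, rfl⟩ := hx
  simp only [map_add, map_mul, map_intCast, conj_omega] at h
  have := intCast_add_mul_omega_inj (a := a - b) (b := -b) (c := a) (d := b)
    (by push_cast; linear_combination h)
  obtain rfl : b = 0 := by omega
  exact ⟨a, by simp⟩

lemma dvd_of_mul_intCast_eq {x : ℂ} {D a b : ℤ} (hx : x ∈ Eis)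
    (h : x * D = a + b * ω) : D ∣ a ∧ D ∣ b := by
  obtain ⟨c, d, rfl⟩ := hx
  have := intCast_add_mul_omega_inj (a := c * D) (b := d * D) (c := a) (d := b)
    (by push_cast; linear_combination h)
  exact ⟨⟨c, by linarith⟩, ⟨d, by linarith⟩⟩

/-- The form with Gram matrix `B` is isometric over `𝔼` to the one with Gram matrix `Jmat`. -/
def IsometricJ (B : Matrix (Fin 2) (Fin 2) ℂ) : Prop :=
  ∃ P Q : Matrix (Fin 2) (Fin 2) ℂ,
    (∀ i j, P i j ∈ Eis) ∧ (∀ i j, Q i j ∈ Eis) ∧ P * Q = 1 ∧ Q * P = 1 ∧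
      Pᵀ * Jmat * P.map (starRingEnd ℂ) = B

lemma mul_mem_Eis {P Q : Matrix (Fin 2) (Fin 2) ℂ} (hP : ∀ i j, P i j ∈ Eis)
    (hQ : ∀ i j, Q i j ∈ Eis) (i j : Fin 2) : (P * Q) i j ∈ Eis := by
  rw [Matrix.mul_apply, Fin.sum_univ_two]
  exact eis_add (eis_mul (hP _ _) (hQ _ _)) (eis_mul (hP _ _) (hQ _ _))

lemma IsometricJ.of_basis_change {B S T : Matrix (Fin 2) (Fin 2) ℂ}
    (hS : ∀ i j, S i j ∈ Eis) (hT : ∀ i j, T i j ∈ Eis) (hST : S * T = 1) (hTS : T * S = 1)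
    (h : IsometricJ (Sᵀ * B * S.map (starRingEnd ℂ))) : IsometricJ B := by
  obtain ⟨P, Q, hP, hQ, hPQ, hQP, hB⟩ := h
  refine ⟨P * T, S * Q, mul_mem_Eis hP hT, mul_mem_Eis hS hQ, ?_, ?_, ?_⟩
  · rw [Matrix.mul_assoc, ← Matrix.mul_assoc T, hTS, Matrix.one_mul, hPQ]
  · rw [Matrix.mul_assoc, ← Matrix.mul_assoc Q, hQP, Matrix.one_mul, hST]
  · have h1 : Tᵀ * Sᵀ = 1 := by rw [← Matrix.transpose_mul, hST, Matrix.transpose_one]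
    have h2 : S.map (starRingEnd ℂ) * T.map (starRingEnd ℂ) = 1 := by
      rw [← Matrix.map_mul, hST, Matrix.map_one _ (map_zero _) (map_one _)]
    calc (P * T)ᵀ * Jmat * (P * T).map (starRingEnd ℂ)
        = Tᵀ * (Pᵀ * Jmat * P.map (starRingEnd ℂ)) * T.map (starRingEnd ℂ) := by
          rw [Matrix.map_mul, Matrix.transpose_mul]; simp only [Matrix.mul_assoc]
      _ = (Tᵀ * Sᵀ) * B * (S.map (starRingEnd ℂ) * T.map (starRingEnd ℂ)) := by
          rw [hB]; simp only [Matrix.mul_assoc]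
      _ = B := by rw [h1, h2, Matrix.one_mul, Matrix.mul_one]

lemma IsometricJ.hermB_eq {B : Matrix (Fin 2) (Fin 2) ℂ} (h : IsometricJ B) :
    ∃ P Q : Matrix (Fin 2) (Fin 2) ℂ,
      (∀ i j, P i j ∈ Eis) ∧ (∀ i j, Q i j ∈ Eis) ∧ P * Q = 1 ∧ Q * P = 1 ∧
      ∀ x y : Fin 2 → ℂ, hermB Jmat (P *ᵥ x) (P *ᵥ y) = hermB B x y := by
  obtain ⟨P, Q, hP, hQ, hPQ, hQP, rfl⟩ := h
  refine ⟨P, Q, hP, hQ, hPQ, hQP, fun x y => ?_⟩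
  simp only [hermB, Matrix.mulVec, dotProduct, Matrix.mul_apply, Matrix.transpose_apply,
    Matrix.map_apply, Fin.sum_univ_two, star_add, star_mul', starRingEnd_apply]
  ring

/-- The Gram matrix `[[3a, θb], [-θ b̄, 3c]]` with `b = x + yω`. -/
def gramTheta (a x y c : ℤ) : Matrix (Fin 2) (Fin 2) ℂ :=
  !![3 * (a : ℂ), θ * (x + y * ω); -θ * (x - y - y * ω), 3 * (c : ℂ)]

lemma exists_int_near (n : ℤ) {a : ℤ} (ha : a ≠ 0) : ∃ p : ℤ, |2 * (n - 3 * a * p)| ≤ |3 * a| := by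
  refine ⟨round ((n : ℚ) / (3 * a)), ?_⟩
  have ha' : (3 * a : ℚ) ≠ 0 := by
    have : (a : ℚ) ≠ 0 := by exact_mod_cast ha
    positivity
  have h := abs_sub_round ((n : ℚ) / (3 * a))
  have h2 : (2 * (n - 3 * a * (round ((n : ℚ) / (3 * a)) : ℤ)) : ℚ) =
      (2 * ((n : ℚ) / (3 * a) - (round ((n : ℚ) / (3 * a)) : ℤ))) * (3 * a) := by
    field_simp
  have h3 : |(2 * (n - 3 * a * (round ((n : ℚ) / (3 * a)) : ℤ)) : ℚ)| ≤ |(3 * a : ℚ)| := by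
    rw [h2, abs_mul, abs_mul, abs_two]
    nlinarith [abs_nonneg (3 * a : ℚ)]
  exact_mod_cast h3

lemma isometricJ_gramTheta_zero {x y c : ℤ} (h : x ^ 2 - x * y + y ^ 2 = 1) :
    IsometricJ (gramTheta 0 x y c) := by
  have h' : (x ^ 2 - x * y + y ^ 2 : ℂ) = 1 := by exact_mod_cast h
  have hb : (x + y * ω : ℂ) ∈ Eis := ⟨x, y, rfl⟩
  have hb' : (x - y - y * ω : ℂ) ∈ Eis := ⟨x - y, -y, by push_cast; ring⟩
  have hω : ω ∈ Eis := ⟨0, 1, by simp⟩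
  have hc := intCast_mem_Eis c
  have hsq := omega_sq
  refine ⟨!![1, -(c * ω * (x - y - y * ω)); 0, x - y - y * ω],
    !![1, c * ω; 0, x + y * ω], ?_, ?_, ?_, ?_, ?_⟩
  · intro i j
    fin_cases i <;> fin_cases j
    exacts [one_mem_Eis, eis_neg (eis_mul (eis_mul hc hω) hb'), zero_mem_Eis, hb']
  · intro i j
    fin_cases i <;> fin_cases j
    exacts [one_mem_Eis, eis_mul hc hω, zero_mem_Eis, hb]
  · ext i j
    fin_cases i <;> fin_cases j <;> simp [Matrix.mul_apply, Fin.sum_univ_two] <;> grind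
  · ext i j
    fin_cases i <;> fin_cases j <;> simp [Matrix.mul_apply, Fin.sum_univ_two] <;> grind
  · ext i j
    fin_cases i <;> fin_cases j <;>
      simp [Matrix.mul_apply, Fin.sum_univ_two, gramTheta, Jmat, conj_omega, theta_eq] <;> grind

lemma gramTheta_basis_change (a x y c p q : ℤ) : ∃ S T : Matrix (Fin 2) (Fin 2) ℂ,
    (∀ i j, S i j ∈ Eis) ∧ (∀ i j, T i j ∈ Eis) ∧ S * T = 1 ∧ T * S = 1 ∧
      Sᵀ * gramTheta a x y c * S.map (starRingEnd ℂ) =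
        gramTheta (c + (q * x - p * y) + a * (p ^ 2 - p * q + q ^ 2))
          (-((x - a * (p - 2 * q)) - (y - a * (2 * p - q)))) (y - a * (2 * p - q)) a := by
  have hl : (p - q - q * ω : ℂ) ∈ Eis := ⟨p - q, -q, by push_cast; ring⟩
  have hsq := omega_sq
  refine ⟨!![p - q - q * ω, 1; 1, 0], !![0, 1; 1, -(p - q - q * ω)], ?_, ?_, ?_, ?_, ?_⟩
  · intro i j
    fin_cases i <;> fin_cases j
    exacts [hl, one_mem_Eis, one_mem_Eis, zero_mem_Eis]
  · intro i j
    fin_cases i <;> fin_cases j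
    exacts [zero_mem_Eis, one_mem_Eis, one_mem_Eis, eis_neg hl]
  · ext i j
    fin_cases i <;> fin_cases j <;> simp [Matrix.mul_apply, Fin.sum_univ_two]
  · ext i j
    fin_cases i <;> fin_cases j <;> simp [Matrix.mul_apply, Fin.sum_univ_two]
  · ext i j
    fin_cases i <;> fin_cases j <;>
      simp [Matrix.mul_apply, Fin.sum_univ_two, gramTheta, conj_omega, theta_eq] <;> grind

theorem isometricJ_gramTheta (n : ℕ) : ∀ a x y c : ℤ, a.natAbs = n →
    x ^ 2 - x * y + y ^ 2 = 1 + 3 * a * c → IsometricJ (gramTheta a x y c) := by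
  induction n using Nat.strong_induction_on with
  | _ n ih =>
    intro a x y c hn h
    by_cases ha : a = 0
    · subst ha
      exact isometricJ_gramTheta_zero (by linarith)
    obtain ⟨p, hp⟩ := exists_int_near (2 * y - x) ha
    obtain ⟨q, hq⟩ := exists_int_near (y - 2 * x) ha
    obtain ⟨S, T, hS, hT, hST, hTS, hB⟩ := gramTheta_basis_change a x y c p q
    refine IsometricJ.of_basis_change hS hT hST hTS ?_
    rw [hB]
    set c' := c + (q * x - p * y) + a * (p ^ 2 - p * q + q ^ 2) with hc'
    set x' := x - a * (p - 2 * q) with hx'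
    set y' := y - a * (2 * p - q) with hy'
    have hN : x' ^ 2 - x' * y' + y' ^ 2 = 1 + 3 * a * c' := by
      rw [hc', hx', hy']; linear_combination h
    refine ih c'.natAbs ?_ _ _ _ _ rfl (by linear_combination hN)
    have hr : 2 * y - x - 3 * a * p = 2 * y' - x' := by rw [hx', hy']; ring
    have hs : y - 2 * x - 3 * a * q = y' - 2 * x' := by rw [hx', hy']; ring
    rw [hr] at hp
    rw [hs] at hq
    have hp2 := sq_le_sq.mpr hp
    have hq2 := sq_le_sq.mpr hq
    have hnn : 0 ≤ x' ^ 2 - x' * y' + y' ^ 2 := by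
      nlinarith [sq_nonneg (x' - y'), sq_nonneg x', sq_nonneg y']
    have hle : 4 * (x' ^ 2 - x' * y' + y' ^ 2) ≤ 9 * a ^ 2 := by
      nlinarith [sq_nonneg ((2 * y' - x') + (y' - 2 * x'))]
    rw [← hn, Int.natAbs_lt_iff_sq_lt]
    have hac : 0 ≤ a * c' := by
      have h3 : 3 * a * c' = 3 * (a * c') := by ring
      omega
    have hapos : 0 < a ^ 2 := by positivity
    have hlt : a * c' < a ^ 2 := by nlinarith
    nlinarith

lemma hermB_expand (B : Matrix (Fin 2) (Fin 2) ℂ) (x y : Fin 2 → ℂ) :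
    hermB B x y = x 0 * B 0 0 * (starRingEnd ℂ) (y 0) + x 0 * B 0 1 * (starRingEnd ℂ) (y 1) +
      (x 1 * B 1 0 * (starRingEnd ℂ) (y 0) + x 1 * B 1 1 * (starRingEnd ℂ) (y 1)) := by
  simp [hermB, Fin.sum_univ_two]

/-- Completing the square for a binary hermitian form. -/
lemma mul_hermB_self_re {B : Matrix (Fin 2) (Fin 2) ℂ} {m n : ℤ} {b : ℂ} (h00 : B 0 0 = m)
    (h11 : B 1 1 = n) (h01 : B 0 1 = b) (h10 : B 1 0 = (starRingEnd ℂ) b) (u : Fin 2 → ℂ) :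
    m * (hermB B u u).re =
      Complex.normSq (m * u 0 + (starRingEnd ℂ) b * u 1) +
        (m * n - Complex.normSq b) * Complex.normSq (u 1) := by
  rw [hermB_expand, h00, h11, h01, h10]
  simp [Complex.normSq_apply]
  ring

lemma normSq_intCast_add_mul_omega (x y : ℤ) :
    Complex.normSq (x + y * ω) = ((x ^ 2 - x * y + y ^ 2 : ℤ) : ℝ) := by
  have h : ((Complex.normSq (x + y * ω) : ℝ) : ℂ) = ((x ^ 2 - x * y + y ^ 2 : ℤ) : ℂ) := by
    rw [Complex.normSq_eq_conj_mul_self]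
    simp only [map_add, map_mul, map_intCast, conj_omega]
    push_cast
    linear_combination (-(y : ℂ) ^ 2) * omega_sq
  exact_mod_cast h

lemma det_neg_of_indefinite {B : Matrix (Fin 2) (Fin 2) ℂ} {m n : ℤ} {b : ℂ} (h00 : B 0 0 = m)
    (h11 : B 1 1 = n) (h01 : B 0 1 = b) (h10 : B 1 0 = (starRingEnd ℂ) b)
    (hne : (m * n - Complex.normSq b : ℝ) ≠ 0) {u v : Fin 2 → ℂ}
    (hu : 0 < (hermB B u u).re) (hv : (hermB B v v).re < 0) :
    (m * n - Complex.normSq b : ℝ) < 0 := by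
  by_contra hlt
  have hpos : 0 < (m * n - Complex.normSq b : ℝ) := lt_of_le_of_ne (not_lt.mp hlt) hne.symm
  have key : ∀ w : Fin 2 → ℂ, 0 ≤ m * (hermB B w w).re := fun w => by
    rw [mul_hermB_self_re h00 h11 h01 h10]
    have := mul_nonneg hpos.le (Complex.normSq_nonneg (w 1))
    have := Complex.normSq_nonneg (m * w 0 + (starRingEnd ℂ) b * w 1)
    linarith
  have hm0 : (m : ℝ) ≠ 0 := by
    intro h0
    rw [h0] at hpos
    linarith [Complex.normSq_nonneg b]
  rcases lt_or_gt_of_ne hm0 with hm | hm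
  · nlinarith [key u]
  · nlinarith [key v]

/-- A negative determinant `D` of an integral binary hermitian form for which multiplication by `θ`
maps the dual lattice into the lattice is `-1` or `-3`. -/
lemma det_eq_neg_one_or_neg_three {m n x y D : ℤ} (hD : D = m * n - (x ^ 2 - x * y + y ^ 2)) (hneg : D < 0)
    (hm : D ∣ m) (hn : D ∣ n) (h1 : D ∣ x - 2 * y) (h2 : D ∣ 2 * x - y) :
    D = -1 ∨ D = -3 := by
  obtain ⟨m', rfl⟩ := hm
  obtain ⟨n', rfl⟩ := hn
  obtain ⟨s, hs⟩ := h1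
  obtain ⟨t, ht⟩ := h2
  have h3 : 3 * D = D * (D * (3 * (m' * n') - (s ^ 2 - s * t + t ^ 2))) := by
    have hN : 3 * (x ^ 2 - x * y + y ^ 2) = D ^ 2 * (s ^ 2 - s * t + t ^ 2) := by
      calc 3 * (x ^ 2 - x * y + y ^ 2)
          = (x - 2 * y) ^ 2 - (x - 2 * y) * (2 * x - y) + (2 * x - y) ^ 2 := by ring
        _ = _ := by rw [hs, ht]; ring
    linear_combination 3 * hD - hN
  have h4 : D ∣ 3 :=
    ⟨3 * (m' * n') - (s ^ 2 - s * t + t ^ 2), mul_left_cancel₀ hneg.ne (by linear_combination h3)⟩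
  have h5 : -D ≤ 3 := Int.le_of_dvd (by norm_num) (by simpa using h4)
  have : D = -1 ∨ D = -2 ∨ D = -3 := by omega
  rcases this with h | h | h
  · exact Or.inl h
  · rw [h] at h4; norm_num at h4
  · exact Or.inr h

theorem statement2 (B : Matrix (Fin 2) (Fin 2) ℂ)
    (hBE : ∀ i j, B i j ∈ Eis) (hBherm : Bᴴ = B) (hBnd : B.det ≠ 0)
    -- signature (1,1) of the induced hermitian form on H'⊗ℂ:
    (hsig : ∃ u v : Fin 2 → ℂ, LinearIndependent ℂ ![u, v] ∧ hermB B u v = 0 ∧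
      0 < (hermB B u u).re ∧ (hermB B v v).re < 0)
    -- an isomorphism of finite hermitian spaces D(H') ≅ V, at representative level:
    (hdisc : ∃ φ : (Fin 2 → ℂ) → (Fin 2 → ℂ),
      (∀ v ∈ dualB B, ∀ i, φ v i ∈ Eis) ∧
      (∀ v ∈ E2lat, ∀ i, φ v i ∈ thetaE) ∧
      (∀ v ∈ dualB B, ∀ w ∈ dualB B, ∀ i, φ (v + w) i - φ v i - φ w i ∈ thetaE) ∧
      (∀ e ∈ Eis, ∀ v ∈ dualB B, ∀ i, φ (e • v) i - e * φ v i ∈ thetaE) ∧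
      (∀ a : Fin 2 → ℂ, (∀ i, a i ∈ Eis) → ∃ v ∈ dualB B, ∀ i, φ v i - a i ∈ thetaE) ∧
      (∀ v ∈ dualB B, (∀ i, φ v i ∈ thetaE) → v ∈ E2lat) ∧
      (∀ v ∈ dualB B, ∀ w ∈ dualB B,
        hermB B v w - (φ v 0 * star (φ w 1) - φ v 1 * star (φ w 0)) * θ / 3 ∈ Eis)) :
    ∃ P Q : Matrix (Fin 2) (Fin 2) ℂ,
      (∀ i j, P i j ∈ Eis) ∧ (∀ i j, Q i j ∈ Eis) ∧ P * Q = 1 ∧ Q * P = 1 ∧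
      ∀ x y : Fin 2 → ℂ, hermB Jmat (P *ᵥ x) (P *ᵥ y) = hermB B x y := by
  obtain ⟨u, v, -, -, hu, hv⟩ := hsig
  obtain ⟨φ, hφE, hφlat, -, hφsmul, hφsurj, hφker, -⟩ := hdisc
  have hconj : ∀ i j, (starRingEnd ℂ) (B j i) = B i j := fun i j => congrFun (congrFun hBherm i) j
  obtain ⟨m, h00⟩ := exists_int_of_conj_eq (hBE 0 0) (hconj 0 0)
  obtain ⟨n, h11⟩ := exists_int_of_conj_eq (hBE 1 1) (hconj 1 1)
  obtain ⟨x, y, h01⟩ := hBE 0 1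
  have h10 : B 1 0 = x - y - y * ω := by
    rw [← hconj 1 0, h01]
    simp only [map_add, map_mul, map_intCast, conj_omega]
    ring
  have h10' : B 1 0 = (starRingEnd ℂ) (x + y * ω) := by rw [← h01, hconj]
  obtain ⟨D, hD⟩ : ∃ D : ℤ, D = m * n - (x ^ 2 - x * y + y ^ 2) := ⟨_, rfl⟩
  have hDC : (D : ℂ) = m * n - (x + y * ω) * (x - y - y * ω) := by
    rw [hD]; push_cast
    linear_combination (-(y : ℂ) ^ 2) * omega_sq
  have hDR : (m * n - Complex.normSq (x + y * ω) : ℝ) = D := by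
    rw [normSq_intCast_add_mul_omega, hD]; push_cast; ring
  have hdet : (D : ℂ) ≠ 0 := by
    rwa [Matrix.det_fin_two, h00, h01, h10, h11, ← hDC] at hBnd
  have hD0 : D ≠ 0 := by exact_mod_cast hdet
  have hneg : D < 0 := by
    have := det_neg_of_indefinite h00 h11 h01 h10' (by rw [hDR]; exact_mod_cast hD0) hu hv
    rw [hDR] at this
    exact_mod_cast this
  have hθdual : ∀ w ∈ dualB B, ∀ i, θ * w i ∈ Eis := fun w hw => by
    have hθw : θ • w ∈ dualB B := fun z hz => by
      have := eis_mul theta_mem_Eis (hw z hz)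
      convert this using 1
      simp only [hermB_expand, Pi.smul_apply, smul_eq_mul]
      ring
    refine hφker _ hθw fun i => ?_
    obtain ⟨z, hz, hzi⟩ := hφsmul θ theta_mem_Eis w hw i
    exact ⟨z + φ w i, eis_add hz (hφE w hw i), by linear_combination hzi⟩
  have hd1 : ![(n : ℂ) / D, -(x + y * ω) / D] ∈ dualB B := fun z hz => by
    have : hermB B ![(n : ℂ) / D, -(x + y * ω) / D] z = (starRingEnd ℂ) (z 0) := by
      rw [hermB_expand, h00, h01, h10, h11]
      simp only [Matrix.cons_val_zero, Matrix.cons_val_one]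
      field_simp
      rw [hDC]
      ring
    rw [this]
    exact eis_conj (hz 0)
  have hd2 : ![-(x - y - y * ω : ℂ) / D, (m : ℂ) / D] ∈ dualB B := fun z hz => by
    have : hermB B ![-(x - y - y * ω : ℂ) / D, (m : ℂ) / D] z = (starRingEnd ℂ) (z 1) := by
      rw [hermB_expand, h00, h01, h10, h11]
      simp only [Matrix.cons_val_zero, Matrix.cons_val_one]
      field_simp
      rw [hDC]
      ring
    rw [this]
    exact eis_conj (hz 1)
  have hDn : D ∣ n := (dvd_of_mul_intCast_eq (a := n) (b := 2 * n) (hθdual _ hd1 0) (by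
    change θ * ((n : ℂ) / D) * D = _
    rw [theta_eq]
    field_simp; push_cast; ring)).1
  have hDm : D ∣ m := (dvd_of_mul_intCast_eq (a := m) (b := 2 * m) (hθdual _ hd2 1) (by
    change θ * ((m : ℂ) / D) * D = _
    rw [theta_eq]
    field_simp; push_cast; ring)).1
  have hDb : D ∣ -(x - 2 * y) ∧ D ∣ -(2 * x - y) :=
    dvd_of_mul_intCast_eq (hθdual _ hd1 1) (by
      have := theta_mul x y
      push_cast at this ⊢
      change θ * (-(x + y * ω) / D) * D = _
      field_simp
      linear_combination -this)
  rw [dvd_neg, dvd_neg] at hDb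
  rcases det_eq_neg_one_or_neg_three hD hneg hDm hDn hDb.1 hDb.2 with hD1 | hD3
  · exfalso
    obtain ⟨w, hw, hwφ⟩ := hφsurj (fun _ => 1) fun _ => one_mem_Eis
    have hwE : w ∈ E2lat := by
      have e0 := hw ![1, 0] (by intro i; fin_cases i; exacts [one_mem_Eis, zero_mem_Eis])
      have e1 := hw ![0, 1] (by intro i; fin_cases i; exacts [zero_mem_Eis, one_mem_Eis])
      rw [hermB_expand] at e0 e1
      simp only [Matrix.cons_val_zero, Matrix.cons_val_one, map_one, map_zero, mul_zero, mul_one,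
        add_zero, zero_add] at e0 e1
      have hdet1 : B 0 0 * B 1 1 - B 0 1 * B 1 0 = -1 := by
        rw [h00, h01, h10, h11, ← hDC, hD1]; norm_num
      intro i
      fin_cases i
      · have := eis_add (eis_mul e1 (hBE 1 0)) (eis_neg (eis_mul e0 (hBE 1 1)))
        convert this using 1
        simp only [Fin.zero_eta]
        linear_combination w 0 * hdet1
      · have := eis_add (eis_mul e0 (hBE 0 1)) (eis_neg (eis_mul e1 (hBE 0 0)))
        convert this using 1
        simp only [Fin.mk_one]
        linear_combination w 1 * hdet1
    have := thetaE_sub (hφlat w hwE 0) (hwφ 0)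
    exact one_notMem_thetaE (by simpa using this)
  · apply IsometricJ.hermB_eq
    rw [hD3, neg_dvd] at hDn hDm hDb
    rw [neg_dvd] at hDb
    obtain ⟨a, rfl⟩ := hDm
    obtain ⟨c, rfl⟩ := hDn
    obtain ⟨⟨s, hs⟩, ⟨t, ht⟩⟩ := hDb
    obtain rfl : x = 2 * t - s := by omega
    obtain rfl : y = t - 2 * s := by omega
    have hB : B = gramTheta a (-s) (-t) c := by
      have hsq := omega_sq
      ext i j
      fin_cases i <;> fin_cases j <;>
        simp [gramTheta, h00, h01, h10, h11, theta_eq] <;> grind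
    rw [hB]
    exact isometricJ_gramTheta _ _ _ _ _ rfl (by nlinarith)
end
end

section
/- The Weyl group W(D₃), i.e. the subgroup of Aut(D₃) generated by the reflections σ_v for vectors v ∈ D₃ of norm 2, is isomorphic to the group G generated inside GL₃(𝔼) by the 3×3 permutation matrices and the diagonal matrix diag(1, ω, ω²); in particular W(D₃) has order 54. -/
/- STATEMENT 5: The Weyl group W(D₃), the subgroup of Aut(D₃) generated by the
reflections σ_v(w) = w − (w,v)v in vectors v ∈ D₃ of norm 2, is isomorphic to the
subgroup G of GL₃(𝔼) generated by the 3×3 permutation matrices and diag(1,ω,ω²);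
in particular W(D₃) has order 54. -/

noncomputable section

open Complex Matrix BigOperators

def hermStd3 (x y : Fin 3 → ℂ) : ℂ := ∑ i, x i * star (y i)

def D3Set : Set (Fin 3 → ℂ) := {x | (∀ i, x i ∈ Eis) ∧ x 0 + x 1 + x 2 ∈ thetaE}

/-- The matrix of the reflection σ_v(w) = w − (w,v)·v. -/
def reflMat3 (v : Fin 3 → ℂ) : Matrix (Fin 3) (Fin 3) ℂ :=
  1 - Matrix.of fun i j => v i * star (v j)

/-- The Weyl group W(D₃), generated by the reflections in norm-2 vectors of D₃. -/
def WeylD3 : Subgroup (GL (Fin 3) ℂ) :=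
  Subgroup.closure {g | ∃ v ∈ D3Set, hermStd3 v v = 2 ∧
    (g : Matrix (Fin 3) (Fin 3) ℂ) = reflMat3 v}

def diagOmega : Matrix (Fin 3) (Fin 3) ℂ := Matrix.diagonal ![1, ω, ω ^ 2]

/-- The group G = G(3,3,3) ⊂ GL₃(𝔼), generated by the permutation matrices and
diag(1, ω, ω²). -/
def Ggrp : Subgroup (GL (Fin 3) ℂ) :=
  Subgroup.closure {g | (g : Matrix (Fin 3) (Fin 3) ℂ) = diagOmega ∨
    ∃ σ : Equiv.Perm (Fin 3), (g : Matrix (Fin 3) (Fin 3) ℂ) = σ.permMatrix ℂ}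

/-! ### Cube roots of unity and Eisenstein integers -/

lemma omega_isPrimitiveRoot : IsPrimitiveRoot ω 3 := by
  have h := Complex.isPrimitiveRoot_exp 3 (by norm_num)
  simpa [ω] using h

/-- The character `k ↦ ω ^ k` of `ℤ/3`. -/
def omegaPow (k : ZMod 3) : ℂ := ω ^ k.val

lemma omegaPow_zero : omegaPow 0 = 1 := by simp [omegaPow]

lemma omegaPow_one : omegaPow 1 = ω := by simp [omegaPow, ZMod.val_one]

lemma omegaPow_two : omegaPow 2 = ω ^ 2 := rfl

lemma omegaPow_add (k l : ZMod 3) : omegaPow (k + l) = omegaPow k * omegaPow l := by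
  rw [omegaPow, omegaPow, omegaPow, ← pow_add, ZMod.val_add]
  exact (pow_eq_pow_mod _ omega_isPrimitiveRoot.pow_eq_one).symm

lemma omegaPow_ne_zero (k : ZMod 3) : omegaPow k ≠ 0 :=
  pow_ne_zero _ (omega_isPrimitiveRoot.ne_zero (by norm_num))

lemma omegaPow_neg (k : ZMod 3) : omegaPow (-k) = (omegaPow k)⁻¹ := by
  apply eq_inv_of_mul_eq_one_left
  rw [← omegaPow_add, neg_add_cancel, omegaPow_zero]

lemma omegaPow_injective : Function.Injective omegaPow := fun k l h =>
  ZMod.val_injective 3 (omega_isPrimitiveRoot.pow_inj (ZMod.val_lt k) (ZMod.val_lt l) h)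

lemma star_omegaPow (k : ZMod 3) : star (omegaPow k) = omegaPow (-k) := by
  rw [omegaPow_neg, omegaPow, star_pow, ← inv_pow,
    Complex.inv_eq_conj (Complex.norm_eq_one_of_pow_eq_one omega_isPrimitiveRoot.pow_eq_one
      (by norm_num))]
  rfl

lemma star_omega : star ω = ω ^ 2 := by
  have h := star_omegaPow 1
  rwa [omegaPow_one, show (-1 : ZMod 3) = 2 from rfl, omegaPow_two] at h

lemma omegaPow_mem_Eis (k : ZMod 3) : omegaPow k ∈ Eis := by
  have hk : k = 0 ∨ k = 1 ∨ k = 2 := by revert k; decide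
  rcases hk with rfl | rfl | rfl
  · exact ⟨1, 0, by simp [omegaPow_zero]⟩
  · exact ⟨0, 1, by simp [omegaPow_one]⟩
  · exact ⟨-1, -1, by rw [omegaPow_two, omega_sq]; push_cast; ring⟩

lemma one_sub_omegaPow_mem_thetaE (k : ZMod 3) : 1 - omegaPow k ∈ thetaE := by
  have hk : k = 0 ∨ k = 1 ∨ k = 2 := by revert k; decide
  rcases hk with rfl | rfl | rfl
  · exact ⟨0, ⟨0, 0, by simp⟩, by simp [omegaPow_zero]⟩
  · refine ⟨_, ⟨-1, -1, rfl⟩, ?_⟩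
    rw [omegaPow_one, θ]
    push_cast
    linear_combination (1 - ω) * omega_sq
  · refine ⟨_, ⟨0, -1, rfl⟩, ?_⟩
    rw [omegaPow_two, θ]
    push_cast
    linear_combination (1 - ω) * omega_sq

lemma Eis_mul_star (a b : ℤ) :
    ((a : ℂ) + b * ω) * star ((a : ℂ) + b * ω) = ((a ^ 2 - a * b + b ^ 2 : ℤ) : ℂ) := by
  simp only [star_add, star_mul', star_omega, star_intCast]
  push_cast
  linear_combination (a * b + b ^ 2 * (ω - 1)) * omega_sq

lemma int_sq_sub_mul_add_sq_nonneg (a b : ℤ) : 0 ≤ a ^ 2 - a * b + b ^ 2 := by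
  nlinarith [sq_nonneg (a - b), sq_nonneg a, sq_nonneg b]

lemma Eis_eq_zero {a b : ℤ} (h : (a : ℂ) + b * ω = 0) : a = 0 ∧ b = 0 := by
  have h1 := Eis_mul_star a b
  rw [h, zero_mul] at h1
  have h2 : a ^ 2 - a * b + b ^ 2 = 0 := by exact_mod_cast h1.symm
  constructor <;> nlinarith [sq_nonneg (a - b), sq_nonneg a, sq_nonneg b]

lemma three_dvd_of_mem_thetaE {a b : ℤ} (h : (a : ℂ) + b * ω ∈ thetaE) : 3 ∣ a + b := by
  obtain ⟨w, ⟨c, d, rfl⟩, hw⟩ := h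
  have h0 : ((a - (c - 2 * d) : ℤ) : ℂ) + ((b - (2 * c - d) : ℤ) : ℂ) * ω = 0 := by
    rw [θ] at hw
    push_cast
    linear_combination hw + (-c + d * (1 - ω + 1)) * omega_sq
  obtain ⟨h1, h2⟩ := Eis_eq_zero h0
  exact ⟨c - d, by linarith⟩

/-- An Eisenstein integer of norm at most `2` is zero or a unit. -/
lemma Eis_small {a b : ℤ} (h : a ^ 2 - a * b + b ^ 2 ≤ 2) :
    ∃ (n : ℤ) (k : ZMod 3), (n = 0 ∨ n = 1 ∨ n = -1) ∧ (a : ℂ) + b * ω = n * omegaPow k ∧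
      n ^ 2 = a ^ 2 - a * b + b ^ 2 ∧ (3 : ℤ) ∣ a + b - n := by
  have ha1 : a ≤ 1 := by nlinarith [sq_nonneg (a - 2 * b)]
  have ha2 : -1 ≤ a := by nlinarith [sq_nonneg (a - 2 * b)]
  have hb1 : b ≤ 1 := by nlinarith [sq_nonneg (b - 2 * a)]
  have hb2 : -1 ≤ b := by nlinarith [sq_nonneg (b - 2 * a)]
  have h2 := omega_sq
  interval_cases a <;> interval_cases b
  · exact ⟨1, 2, by simp, by rw [omegaPow_two, h2]; push_cast; ring, by norm_num, by norm_num⟩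
  · exact ⟨-1, 0, by simp, by simp [omegaPow_zero], by norm_num, by norm_num⟩
  · norm_num at h
  · exact ⟨-1, 1, by simp, by simp [omegaPow_one], by norm_num, by norm_num⟩
  · exact ⟨0, 0, by simp, by simp, by norm_num, by norm_num⟩
  · exact ⟨1, 1, by simp, by simp [omegaPow_one], by norm_num, by norm_num⟩
  · norm_num at h
  · exact ⟨1, 0, by simp, by simp [omegaPow_zero], by norm_num, by norm_num⟩
  · exact ⟨-1, 2, by simp, by rw [omegaPow_two, h2]; push_cast; ring, by norm_num, by norm_num⟩

/-! ### Monomial matrices -/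

/-- The monomial matrix with entry `ω ^ a i` in position `(i, σ i)`. -/
def monomialMat (a : Fin 3 → ZMod 3) (σ : Equiv.Perm (Fin 3)) : Matrix (Fin 3) (Fin 3) ℂ :=
  Matrix.of fun i j => if σ i = j then omegaPow (a i) else 0

lemma monomialMat_mul (a b : Fin 3 → ZMod 3) (σ τ : Equiv.Perm (Fin 3)) :
    monomialMat a σ * monomialMat b τ = monomialMat (a + b ∘ σ) (τ * σ) := by
  ext i j
  simp only [monomialMat, Matrix.mul_apply, Matrix.of_apply, ite_mul, zero_mul,
    Finset.sum_ite_eq, Finset.mem_univ, if_true]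
  simp [omegaPow_add]

lemma monomialMat_zero_one : monomialMat 0 1 = 1 := by
  ext i j
  simp [monomialMat, Matrix.one_apply, omegaPow_zero]

lemma monomialMat_injective {a b : Fin 3 → ZMod 3} {σ τ : Equiv.Perm (Fin 3)}
    (h : monomialMat a σ = monomialMat b τ) : a = b ∧ σ = τ := by
  have key (i) : τ i = σ i ∧ omegaPow (a i) = omegaPow (b i) := by
    have hi := congrFun (congrFun h i) (σ i)
    by_cases hτ : τ i = σ i
    · exact ⟨hτ, by simpa [monomialMat, hτ] using hi⟩
    · exact absurd (by simpa [monomialMat, hτ] using hi) (omegaPow_ne_zero (a i))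
  exact ⟨funext fun i => omegaPow_injective (key i).2, Equiv.ext fun i => (key i).1.symm⟩

/-- `monomialMat` as an element of the general linear group. -/
def monomialGL (a : Fin 3 → ZMod 3) (σ : Equiv.Perm (Fin 3)) : GL (Fin 3) ℂ where
  val := monomialMat a σ
  inv := monomialMat (-(a ∘ ⇑σ⁻¹)) σ⁻¹
  val_inv := by
    rw [monomialMat_mul, ← monomialMat_zero_one]
    congr 1
    · ext i; simp
    · simp
  inv_val := by
    rw [monomialMat_mul, ← monomialMat_zero_one]
    congr 1
    · ext i; simp
    · simp

lemma monomialGL_mul (a b : Fin 3 → ZMod 3) (σ τ : Equiv.Perm (Fin 3)) :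
    monomialGL a σ * monomialGL b τ = monomialGL (a + b ∘ σ) (τ * σ) :=
  Units.ext (monomialMat_mul a b σ τ)

lemma monomialGL_zero_one : monomialGL 0 1 = 1 := Units.ext monomialMat_zero_one

lemma monomialGL_inv (a : Fin 3 → ZMod 3) (σ : Equiv.Perm (Fin 3)) :
    (monomialGL a σ)⁻¹ = monomialGL (-(a ∘ ⇑σ⁻¹)) σ⁻¹ := Units.ext rfl

/-- The group `G(3,3,3)` described explicitly: monomial matrices whose nonzero entries are cube
roots of unity with product `1`. -/
def monomialSubgroup : Subgroup (GL (Fin 3) ℂ) where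
  carrier := {g | ∃ a σ, ∑ i, a i = 0 ∧ g = monomialGL a σ}
  one_mem' := ⟨0, 1, by simp, monomialGL_zero_one.symm⟩
  mul_mem' := by
    rintro _ _ ⟨a, σ, ha, rfl⟩ ⟨b, τ, hb, rfl⟩
    refine ⟨_, _, ?_, monomialGL_mul a b σ τ⟩
    simp only [Pi.add_apply, Function.comp_apply, Finset.sum_add_distrib, ha, zero_add]
    rw [Equiv.sum_comp σ b, hb]
  inv_mem' := by
    rintro _ ⟨a, σ, ha, rfl⟩
    refine ⟨_, _, ?_, monomialGL_inv a σ⟩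
    simp only [Pi.neg_apply, Function.comp_apply, Finset.sum_neg_distrib]
    rw [Equiv.sum_comp σ⁻¹ a, ha, neg_zero]

lemma card_monomialSubgroup : Nat.card monomialSubgroup = 54 := by
  let f : (ZMod 3 × ZMod 3) × Equiv.Perm (Fin 3) → monomialSubgroup := fun p =>
    ⟨monomialGL ![p.1.1, p.1.2, -p.1.1 - p.1.2] p.2, _, _, by simp [Fin.sum_univ_three], rfl⟩
  have hf : Function.Bijective f := by
    constructor
    · rintro ⟨⟨a, b⟩, σ⟩ ⟨⟨c, d⟩, τ⟩ h
      obtain ⟨h1, h2⟩ := monomialMat_injective (congrArg (fun g => (g.1 : GL (Fin 3) ℂ).1) h)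
      have h3 : a = c := congrFun h1 0
      have h4 : b = d := congrFun h1 1
      have h5 : σ = τ := h2
      rw [h3, h4, h5]
    · rintro ⟨_, a, σ, ha, rfl⟩
      refine ⟨((a 0, a 1), σ), Subtype.ext ?_⟩
      change monomialGL ![a 0, a 1, -a 0 - a 1] σ = monomialGL a σ
      congr 1
      rw [Fin.sum_univ_three] at ha
      ext i
      fin_cases i
      · rfl
      · rfl
      · change -a 0 - a 1 = a 2
        linear_combination -ha
  rw [← Nat.card_eq_of_bijective f hf, Nat.card_prod, Nat.card_prod, Nat.card_zmod,
    Nat.card_perm, Nat.card_fin]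
  rfl

/-- A subgroup containing the permutation matrices and the diagonal matrices
`diag(ω ^ k, ω ^ (-k), 1)` and `diag(1, ω ^ k, ω ^ (-k))` contains `monomialSubgroup`. -/
lemma monomialSubgroup_le {H : Subgroup (GL (Fin 3) ℂ)}
    (hperm : ∀ σ, monomialGL 0 σ ∈ H) (h01 : ∀ k, monomialGL ![k, -k, 0] 1 ∈ H)
    (h12 : ∀ k, monomialGL ![0, k, -k] 1 ∈ H) : monomialSubgroup ≤ H := by
  rintro _ ⟨a, σ, ha, rfl⟩
  have h := H.mul_mem (H.mul_mem (h01 (a 0)) (h12 (a 0 + a 1))) (hperm σ)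
  rw [monomialGL_mul, monomialGL_mul] at h
  rw [mul_one, mul_one] at h
  convert h using 2
  · rw [Fin.sum_univ_three] at ha
    ext i
    fin_cases i
    · simp
    · simp
    · simp
      linear_combination ha

/-! ### Identification of the two groups -/

lemma permMatrix_eq_monomialMat (σ : Equiv.Perm (Fin 3)) : σ.permMatrix ℂ = monomialMat 0 σ := by
  ext i j
  simp [monomialMat, Equiv.Perm.permMatrix, PEquiv.toMatrix_apply, omegaPow_zero, eq_comm]

lemma diagOmega_eq_monomialMat : diagOmega = monomialMat ![0, 1, 2] 1 := by
  ext i j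
  fin_cases i <;> fin_cases j <;>
    simp [diagOmega, monomialMat, omegaPow_zero, omegaPow_one, omegaPow_two]

lemma Ggrp_eq_monomialSubgroup : Ggrp = monomialSubgroup := by
  apply le_antisymm
  · rw [Ggrp, Subgroup.closure_le]
    rintro g (hg | ⟨σ, hg⟩)
    · exact ⟨![0, 1, 2], 1, by decide, Units.ext (hg.trans diagOmega_eq_monomialMat)⟩
    · exact ⟨0, σ, by simp, Units.ext (hg.trans (permMatrix_eq_monomialMat σ))⟩
  · have hperm (σ) : monomialGL 0 σ ∈ Ggrp :=
      Subgroup.subset_closure (Or.inr ⟨σ, (permMatrix_eq_monomialMat σ).symm⟩)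
    have hdiag : monomialGL ![0, 1, 2] 1 ∈ Ggrp :=
      Subgroup.subset_closure (Or.inl diagOmega_eq_monomialMat.symm)
    have hconj (σ : Equiv.Perm (Fin 3)) : monomialGL (![0, 1, 2] ∘ σ) 1 ∈ Ggrp := by
      have h := Ggrp.mul_mem (Ggrp.mul_mem (hperm σ) hdiag) (hperm σ⁻¹)
      rw [monomialGL_mul, monomialGL_mul] at h
      simpa using h
    have hk (σ : Equiv.Perm (Fin 3)) (k : ZMod 3) : monomialGL (k • (![0, 1, 2] ∘ σ)) 1 ∈ Ggrp := by
      have hk : k = 0 ∨ k = 1 ∨ k = 2 := by revert k; decide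
      rcases hk with rfl | rfl | rfl
      · rw [zero_smul]
        exact hperm 1
      · rw [one_smul]
        exact hconj σ
      · have h := Ggrp.mul_mem (hconj σ) (hconj σ)
        rw [monomialGL_mul] at h
        simpa [two_smul] using h
    refine monomialSubgroup_le hperm (fun k => ?_) fun k => ?_
    · convert hk (Equiv.swap 0 2 * Equiv.swap 0 1) k using 2
      revert k
      decide
    · convert hk 1 k using 2
      revert k
      decide

/-- The vector with coordinates `n i * ω ^ k i`. -/
def unitVec (n : Fin 3 → ℤ) (k : Fin 3 → ZMod 3) : Fin 3 → ℂ := fun i => n i * omegaPow (k i)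

lemma reflMat3_unitVec_apply (n : Fin 3 → ℤ) (k : Fin 3 → ZMod 3) (i j : Fin 3) :
    reflMat3 (unitVec n k) i j =
      (1 : Matrix (Fin 3) (Fin 3) ℂ) i j - (n i * n j : ℤ) * omegaPow (k i - k j) := by
  simp only [reflMat3, unitVec, Matrix.sub_apply, Matrix.of_apply, star_mul', star_intCast,
    star_omegaPow, sub_eq_add_neg, omegaPow_add]
  push_cast
  ring

/-- The reflection in a vector `± (ω ^ k p • e p - ω ^ k q • e q)` is monomial. -/
lemma reflMat3_unitVec {n : Fin 3 → ℤ} (k : Fin 3 → ZMod 3) {p q : Fin 3} (hpq : p ≠ q)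
    (hp : n p ^ 2 = 1) (hq : n q = -n p) (hn : ∀ i, i ≠ p → i ≠ q → n i = 0) :
    reflMat3 (unitVec n k) =
      monomialMat (fun i => k i - k (Equiv.swap p q i)) (Equiv.swap p q) := by
  have hpp : n p * n p = 1 := by rw [← sq, hp]
  ext i j
  rw [reflMat3_unitVec_apply]
  simp only [monomialMat, Matrix.of_apply]
  rcases eq_or_ne i p with rfl | hip
  · rcases eq_or_ne j i with rfl | hji
    · simp [hpp, hpq.symm, omegaPow_zero]
    · rcases eq_or_ne j q with rfl | hjq
      · simp [hq, hpp, hpq]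
      · simp [hn j hji hjq, hji.symm, hjq.symm]
  · rcases eq_or_ne i q with rfl | hiq
    · rcases eq_or_ne j i with rfl | hji
      · simp [hq, hpp, hpq, omegaPow_zero]
      · rcases eq_or_ne j p with rfl | hjp
        · simp [hq, hpp, hip]
        · simp [hn j hjp hji, hji.symm, hjp.symm]
    · simp [hn i hip hiq, Equiv.swap_apply_of_ne_of_ne hip hiq, Matrix.one_apply, omegaPow_zero]

lemma sum_sub_swap (k : Fin 3 → ZMod 3) (σ : Equiv.Perm (Fin 3)) : ∑ i, (k i - k (σ i)) = 0 := by
  rw [Finset.sum_sub_distrib, Equiv.sum_comp σ k, sub_self]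

/-- Norm-two vectors of `D₃` have the form `± (ω ^ k p • e p - ω ^ k q • e q)`. -/
lemma exists_unitVec_of_mem_D3Set {v : Fin 3 → ℂ} (hv : v ∈ D3Set) (h2 : hermStd3 v v = 2) :
    ∃ (n : Fin 3 → ℤ) (k : Fin 3 → ZMod 3) (p q : Fin 3), v = unitVec n k ∧ p ≠ q ∧
      n p ^ 2 = 1 ∧ n q = -n p ∧ ∀ i, i ≠ p → i ≠ q → n i = 0 := by
  obtain ⟨hE, hθ⟩ := hv
  choose a b hab using hE
  have hnorm : ∑ i, (a i ^ 2 - a i * b i + b i ^ 2) = 2 := by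
    simp only [hermStd3, hab, Eis_mul_star] at h2
    exact_mod_cast h2
  have hle (i) : a i ^ 2 - a i * b i + b i ^ 2 ≤ 2 := by
    rw [← hnorm]
    exact Finset.single_le_sum (f := fun i => a i ^ 2 - a i * b i + b i ^ 2)
      (fun j _ => int_sq_sub_mul_add_sq_nonneg _ _) (Finset.mem_univ i)
  have hdvd : (3 : ℤ) ∣ (a 0 + a 1 + a 2) + (b 0 + b 1 + b 2) := by
    apply three_dvd_of_mem_thetaE
    convert hθ using 1
    rw [hab 0, hab 1, hab 2]
    push_cast
    ring
  choose n k hn hnk hsq hmod using fun i => Eis_small (hle i)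
  have hv : v = unitVec n k := funext fun i => (hab i).trans (hnk i)
  rw [Fin.sum_univ_three, ← hsq, ← hsq, ← hsq] at hnorm
  have hsum : (3 : ℤ) ∣ n 0 + n 1 + n 2 := by
    have h0 := hmod 0
    have h1 := hmod 1
    have h2 := hmod 2
    omega
  have hpq : ∃ p q : Fin 3, p ≠ q ∧ n p ^ 2 = 1 ∧ n q = -n p ∧
      ∀ i, i ≠ p → i ≠ q → n i = 0 := by
    rcases hn 0 with h0 | h0 | h0 <;> rcases hn 1 with h1 | h1 | h1 <;>
      rcases hn 2 with h2 | h2 | h2 <;> rw [h0, h1, h2] at hnorm hsum <;>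
      try omega
    · exact ⟨1, 2, by simp [Fin.forall_fin_succ, h0, h1, h2]⟩
    · exact ⟨1, 2, by simp [Fin.forall_fin_succ, h0, h1, h2]⟩
    · exact ⟨0, 2, by simp [Fin.forall_fin_succ, h0, h1, h2]⟩
    · exact ⟨0, 1, by simp [Fin.forall_fin_succ, h0, h1, h2]⟩
    · exact ⟨0, 2, by simp [Fin.forall_fin_succ, h0, h1, h2]⟩
    · exact ⟨0, 1, by simp [Fin.forall_fin_succ, h0, h1, h2]⟩
  obtain ⟨p, q, h⟩ := hpq
  exact ⟨n, k, p, q, hv, h⟩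

/-- The reflection in `e p - ω ^ k • e q` lies in the Weyl group. -/
lemma monomialGL_swap_mem_WeylD3 {p q : Fin 3} (hpq : p ≠ q) (k : ZMod 3) :
    monomialGL (Pi.single p (-k) + Pi.single q k) (Equiv.swap p q) ∈ WeylD3 := by
  refine Subgroup.subset_closure
    ⟨unitVec (Pi.single p 1 - Pi.single q 1) (Pi.single q k), ⟨fun i => ?_, ?_⟩, ?_, ?_⟩
  · obtain ⟨c, d, h⟩ := omegaPow_mem_Eis ((Pi.single q k : Fin 3 → ZMod 3) i)
    refine ⟨(Pi.single p 1 - Pi.single q 1 : Fin 3 → ℤ) i * c,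
      (Pi.single p 1 - Pi.single q 1 : Fin 3 → ℤ) i * d, ?_⟩
    rw [unitVec, h]
    push_cast
    ring
  · convert one_sub_omegaPow_mem_thetaE k using 1
    rw [← Fin.sum_univ_three]
    simp [unitVec, sub_mul, Finset.sum_sub_distrib, Pi.single_apply, hpq, omegaPow_zero]
  · have h (n : Fin 3 → ℤ) (l : Fin 3 → ZMod 3) :
        hermStd3 (unitVec n l) (unitVec n l) = ((∑ i, n i ^ 2 : ℤ) : ℂ) := by
      rw [hermStd3, Int.cast_sum]
      refine Finset.sum_congr rfl fun i _ => ?_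
      rw [unitVec, star_mul', star_intCast, star_omegaPow, mul_mul_mul_comm, ← omegaPow_add,
        add_neg_cancel, omegaPow_zero]
      push_cast
      ring
    rw [h, show ∑ i, (Pi.single p 1 - Pi.single q 1 : Fin 3 → ℤ) i ^ 2 = 2 by
      revert p q; decide]
    norm_num
  · rw [reflMat3_unitVec _ hpq (by simp [hpq]) (by simp [hpq, hpq.symm])
      (fun i hp hq => by simp [hp, hq])]
    change monomialMat _ _ = _
    congr 1
    revert p q k
    decide

lemma WeylD3_eq_monomialSubgroup : WeylD3 = monomialSubgroup := by
  apply le_antisymm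
  · rw [WeylD3, Subgroup.closure_le]
    rintro g ⟨v, hv, h2, hg⟩
    obtain ⟨n, k, p, q, rfl, hpq, hp, hq, hn⟩ := exists_unitVec_of_mem_D3Set hv h2
    exact ⟨_, _, sum_sub_swap k _, Units.ext (hg.trans (reflMat3_unitVec k hpq hp hq hn))⟩
  · have hswap {p q : Fin 3} (hpq : p ≠ q) : monomialGL 0 (Equiv.swap p q) ∈ WeylD3 := by
      simpa using monomialGL_swap_mem_WeylD3 hpq 0
    have hdiag {p q : Fin 3} (hpq : p ≠ q) (k : ZMod 3) :
        monomialGL (Pi.single p k + Pi.single q (-k)) 1 ∈ WeylD3 := by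
      have h := WeylD3.mul_mem (monomialGL_swap_mem_WeylD3 hpq (-k)) (hswap hpq)
      rw [monomialGL_mul] at h
      simpa using h
    refine monomialSubgroup_le (fun σ => ?_) (fun k => ?_) fun k => ?_
    · induction σ using Equiv.Perm.swap_induction_on with
      | one => rw [monomialGL_zero_one]; exact WeylD3.one_mem
      | swap_mul σ p q hpq ih =>
        have h := WeylD3.mul_mem ih (hswap hpq)
        rw [monomialGL_mul] at h
        simpa using h
    · convert hdiag (p := 0) (q := 1) (by decide) k using 2
      revert k
      decide
    · convert hdiag (p := 1) (q := 2) (by decide) k using 2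
      revert k
      decide

theorem statement5 :
    Nonempty (WeylD3 ≃* Ggrp) ∧ Nat.card WeylD3 = 54 := by
  rw [WeylD3_eq_monomialSubgroup, Ggrp_eq_monomialSubgroup]
  exact ⟨⟨MulEquiv.refl _⟩, card_monomialSubgroup⟩
end
end

section
/- There exists a primitive embedding of hermitian lattices f : D₃ → Λ, i.e. an injective 𝔼-linear map with (f(x), f(y))_Λ = (x, y)_{D₃} for all x, y, whose image is a primitive sublattice of Λ (the quotient Λ/f(D₃) is torsion-free). -/
/- STATEMENT 9: There exists a primitive embedding of hermitian lattices
f : D₃ → Λ = (𝔼⁵, -x₁conj(y₁) + Σ_{i≥2} xᵢconj(yᵢ)): an injective 𝔼-linear map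
preserving the forms whose image is a primitive sublattice (Λ/f(D₃) torsion-free).
Such an 𝔼-linear map extends uniquely to ℂ³ → ℂ⁵ and so is given by a 5×3 matrix. -/

noncomputable section

open Complex Matrix BigOperators

def hermL (x y : Fin 5 → ℂ) : ℂ :=
  ∑ i, (if i = (0 : Fin 5) then (-1 : ℂ) else 1) * x i * star (y i)

def LambdaSet : Set (Fin 5 → ℂ) := {x | ∀ i, x i ∈ Eis}

/-- T encodes a primitive embedding of hermitian lattices D₃ → Λ: it maps D₃
injectively into Λ preserving the hermitian forms, and the quotient Λ/T(D₃)
is torsion-free as an 𝔼-module. -/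
def IsPrimEmbed (T : Matrix (Fin 5) (Fin 3) ℂ) : Prop :=
  (∀ v ∈ D3Set, T *ᵥ v ∈ LambdaSet) ∧
  (∀ v ∈ D3Set, T *ᵥ v = 0 → v = 0) ∧
  (∀ v ∈ D3Set, ∀ w ∈ D3Set, hermL (T *ᵥ v) (T *ᵥ w) = hermStd3 v w) ∧
  (∀ x ∈ LambdaSet, ∀ c ∈ Eis, c ≠ 0 →
    (∃ v ∈ D3Set, T *ᵥ v = c • x) → ∃ v ∈ D3Set, T *ᵥ v = x)

theorem omega_ne_one : ω ≠ 1 :=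
  (Complex.isPrimitiveRoot_exp 3 (by norm_num)).ne_one (by norm_num)

theorem theta_ne_zero : θ ≠ 0 := by
  have h : θ = ω * (1 - ω) := by unfold θ; ring
  rw [h]
  exact mul_ne_zero (Complex.exp_ne_zero _) (sub_ne_zero.mpr omega_ne_one.symm)

/-- The matrix of `v ↦ (s, s, v₁, v₂, v₃)` with `s = (v₁ + v₂ + v₃) / θ`. -/
def isotropicGraph : Matrix (Fin 5) (Fin 3) ℂ :=
  !![θ⁻¹, θ⁻¹, θ⁻¹; θ⁻¹, θ⁻¹, θ⁻¹; 1, 0, 0; 0, 1, 0; 0, 0, 1]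

theorem isotropicGraph_mulVec (v : Fin 3 → ℂ) :
    isotropicGraph *ᵥ v =
      ![θ⁻¹ * (v 0 + v 1 + v 2), θ⁻¹ * (v 0 + v 1 + v 2), v 0, v 1, v 2] := by
  ext i
  fin_cases i <;>
    simp [isotropicGraph, Matrix.mulVec, dotProduct, Fin.sum_univ_three, mul_add]

theorem hermL_isotropicGraph_mulVec (v w : Fin 3 → ℂ) :
    hermL (isotropicGraph *ᵥ v) (isotropicGraph *ᵥ w) = hermStd3 v w := by
  rw [isotropicGraph_mulVec, isotropicGraph_mulVec]
  simp [hermL, hermStd3, Fin.sum_univ_succ]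

theorem isotropicGraph_mulVec_mem {v : Fin 3 → ℂ} (hv : v ∈ D3Set) :
    isotropicGraph *ᵥ v ∈ LambdaSet := by
  obtain ⟨hE, s, hs, hsum⟩ := hv
  rw [isotropicGraph_mulVec, hsum, inv_mul_cancel_left₀ theta_ne_zero]
  intro i
  fin_cases i
  exacts [hs, hs, hE 0, hE 1, hE 2]

theorem isotropicGraph_mulVec_injective :
    Function.Injective (isotropicGraph *ᵥ ·) := by
  intro v w h
  simp only [isotropicGraph_mulVec] at h
  ext i
  fin_cases i
  exacts [congrFun h 2, congrFun h 3, congrFun h 4]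

/-- Every lattice vector in the image of `ℂ³` comes from `D₃`. -/
theorem mem_D3Set_of_isotropicGraph_mulVec_mem {v : Fin 3 → ℂ}
    (hv : isotropicGraph *ᵥ v ∈ LambdaSet) : v ∈ D3Set := by
  rw [isotropicGraph_mulVec] at hv
  refine ⟨fun i => ?_, _, hv 0, (mul_inv_cancel_left₀ theta_ne_zero _).symm⟩
  fin_cases i
  exacts [hv 2, hv 3, hv 4]

theorem statement9 : ∃ T : Matrix (Fin 5) (Fin 3) ℂ, IsPrimEmbed T := by
  refine ⟨isotropicGraph, fun v hv => isotropicGraph_mulVec_mem hv,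
    fun v _ h => isotropicGraph_mulVec_injective (by simpa using h),
    fun v _ w _ => hermL_isotropicGraph_mulVec v w, ?_⟩
  rintro x hx c - hc ⟨v, -, hv⟩
  have h : isotropicGraph *ᵥ (c⁻¹ • v) = x := by
    rw [Matrix.mulVec_smul, hv, inv_smul_smul₀ hc]
  exact ⟨c⁻¹ • v, mem_D3Set_of_isotropicGraph_mulVec_mem (h ▸ hx), h⟩
end
end

section
/- Let f be an injective holomorphic map from ℙ¹(ℂ) ∖ {0, 1, ∞} to itself (equivalently, an injective holomorphic function f on ℂ ∖ {0,1} with values in ℂ ∖ {0,1}). Then f is the restriction of a linear fractional transformation: there exist a, b, c, d ∈ ℂ with ad − bc ≠ 0 such that f(z) = (az + b)/(cz + d) for all z ∈ ℂ ∖ {0,1}. -/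
/- STATEMENT 18: An injective holomorphic map from ℙ¹(ℂ) ∖ {0,1,∞} ≅ ℂ ∖ {0,1}
to itself is the restriction of a linear fractional transformation. -/

noncomputable section

/-- ℙ¹(ℂ) ∖ {0,1,∞}, identified with ℂ ∖ {0,1}. -/
def U01 : Set ℂ := {z : ℂ | z ≠ 0 ∧ z ≠ 1}

open Filter Topology in
/-- **Liouville's theorem** with finitely many punctures: a bounded holomorphic function on the
complement of a finite set is constant there. -/
theorem exists_const_of_bounded_on_compl_finite {s : Set ℂ} (hs : s.Finite) :
    ∀ f : ℂ → ℂ, DifferentiableOn ℂ f sᶜ → (∃ M : ℝ, ∀ z ∈ sᶜ, ‖f z‖ ≤ M) →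
      ∃ k : ℂ, ∀ z ∈ sᶜ, f z = k := by
  induction s, hs using Set.Finite.induction_on with
  | empty =>
    rintro f hf ⟨M, hM⟩
    rw [Set.compl_empty, differentiableOn_univ] at hf
    obtain ⟨k, hk⟩ := hf.exists_const_forall_eq_of_bounded
      (isBounded_iff_forall_norm_le.2 ⟨M, by rintro _ ⟨z, rfl⟩; exact hM z (by simp)⟩)
    exact ⟨k, fun z _ => hk z⟩
  | @insert a s has hs ih =>
    rintro f hf ⟨M, hM⟩
    have hcompl : (insert a s)ᶜ = sᶜ \ {a} := by
      ext z; simp [not_or, and_comm]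
    rw [hcompl] at hf hM ⊢
    have hnhds : sᶜ ∈ 𝓝 a := hs.isClosed.isOpen_compl.mem_nhds has
    set g : ℂ → ℂ := Function.update f a (limUnder (𝓝[≠] a) f) with hg
    have hgf : ∀ z, z ≠ a → g z = f z := fun z hz => Function.update_of_ne hz _ _
    have hgd : DifferentiableOn ℂ g sᶜ :=
      Complex.differentiableOn_update_limUnder_of_bddAbove hnhds hf
        ⟨M, by rintro _ ⟨z, hz, rfl⟩; exact hM z hz⟩
    have hgM : ∀ z ∈ sᶜ, ‖g z‖ ≤ M := by
      intro z hz
      rcases eq_or_ne z a with rfl | hza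
      · have hc : Tendsto (fun w => ‖g w‖) (𝓝[≠] z) (𝓝 ‖g z‖) :=
          (hgd.differentiableAt hnhds).continuousAt.norm.tendsto.mono_left nhdsWithin_le_nhds
        refine le_of_tendsto hc ?_
        filter_upwards [self_mem_nhdsWithin, mem_nhdsWithin_of_mem_nhds hnhds] with w hw hws
        rw [hgf w hw]
        exact hM w ⟨hws, hw⟩
      · rw [hgf z hza]
        exact hM z ⟨hz, hza⟩
    obtain ⟨k, hk⟩ := ih g hgd ⟨M, hgM⟩
    exact ⟨k, fun z hz => by rw [← hgf z hz.2, hk z hz.1]⟩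

/-- An injective holomorphic function on a connected open set with at least two points has nonzero
derivative somewhere. -/
theorem exists_deriv_ne_zero_of_injOn {U : Set ℂ} (hU : IsOpen U) (hUc : IsPreconnected U)
    (hU2 : U.Nontrivial) {f : ℂ → ℂ} (hf : DifferentiableOn ℂ f U) (hinj : Set.InjOn f U) :
    ∃ z ∈ U, deriv f z ≠ 0 := by
  by_contra! h
  obtain ⟨x, hx, y, hy, hxy⟩ := hU2
  exact hxy (hinj hx hy (hU.is_const_of_deriv_eq_zero hUc hf h hx hy))

open Filter Topology in
/-- An injective function that is holomorphic at `a` with nonzero derivative keeps a positive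
distance from `f a` outside any neighbourhood of `a`. -/
theorem exists_pos_le_norm_sub_of_injOn {U V : Set ℂ} {a : ℂ} {f : ℂ → ℂ} (hU : U ∈ 𝓝 a)
    (hV : V ∈ 𝓝 a) (hf : DifferentiableOn ℂ f U) (hinj : Set.InjOn f U) (hd : deriv f a ≠ 0) :
    ∃ ε > 0, ∀ z ∈ U, z ∉ V → ε ≤ ‖f z - f a‖ := by
  have hopen : 𝓝 (f a) ≤ map f (𝓝 a) := by
    refine (hf.analyticAt hU).eventually_constant_or_nhds_le_map_nhds.resolve_left fun h => hd ?_
    have h' : f =ᶠ[𝓝 a] fun _ => f a := h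
    rw [h'.deriv_eq, deriv_const]
  have him : f '' (U ∩ V) ∈ 𝓝 (f a) := hopen (image_mem_map (inter_mem hU hV))
  obtain ⟨ε, hε, hball⟩ := Metric.mem_nhds_iff.1 him
  refine ⟨ε, hε, fun z hz hzV => ?_⟩
  by_contra! hlt
  obtain ⟨w, ⟨hwU, hwV⟩, hw⟩ := hball (mem_ball_iff_norm.2 hlt)
  exact hzV (hinj hwU hz hw ▸ hwV)

open Filter Topology in
/-- An injective holomorphic function on the complement of a finite subset of `ℂ` is a linear
fractional transformation. -/
theorem exists_linearFractional_of_injOn_compl_finite {s : Set ℂ} (hs : s.Finite) {f : ℂ → ℂ}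
    (hf : DifferentiableOn ℂ f sᶜ) (hinj : Set.InjOn f sᶜ) :
    ∃ a b c d : ℂ, a * d - b * c ≠ 0 ∧ ∀ z ∈ sᶜ, f z = (a * z + b) / (c * z + d) := by
  have hU : IsOpen sᶜ := hs.isClosed.isOpen_compl
  have hUc : IsPreconnected sᶜ :=
    (hs.countable.isConnected_compl_of_one_lt_rank (by simp)).isPreconnected
  obtain ⟨p, hp, hd⟩ :=
    exists_deriv_ne_zero_of_injOn hU hUc hs.infinite_compl.nontrivial hf hinj
  have hUp : sᶜ ∈ 𝓝 p := hU.mem_nhds hp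
  have hne : ∀ z ∈ sᶜ, z ≠ p → f z - f p ≠ 0 := fun z hz hzp h =>
    hzp (hinj hz hp (sub_eq_zero.1 h))
  set φ : ℂ → ℂ := dslope f p with hφ
  have hφp : φ p = deriv f p := dslope_same f p
  have hφz : ∀ z, z ≠ p → φ z = (f z - f p) / (z - p) := fun z hz => by
    rw [hφ, dslope_of_ne f hz, slope_def_field]
  have hφ0 : ∀ z ∈ sᶜ, φ z ≠ 0 := by
    intro z hz
    rcases eq_or_ne z p with rfl | hzp
    · rwa [hφp]
    · rw [hφz z hzp]
      exact div_ne_zero (hne z hz hzp) (sub_ne_zero.2 hzp)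
  set c : ℂ := (deriv f p)⁻¹ with hc
  have hc0 : c ≠ 0 := inv_ne_zero hd
  -- `h` is `1 / (f - f p)` with its principal part at `p` removed.
  set h : ℂ → ℂ := dslope (fun z => (φ z)⁻¹) p with hh
  have hhz : ∀ z ∈ sᶜ, z ≠ p → h z = (f z - f p)⁻¹ - c / (z - p) := by
    intro z hz hzp
    have h1 := sub_ne_zero.2 hzp
    have h2 := hne z hz hzp
    rw [hh, dslope_of_ne _ hzp, slope_def_field, hφz z hzp, hφp, ← hc]
    field_simp
  have hhd : DifferentiableOn ℂ h sᶜ :=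
    (Complex.differentiableOn_dslope hUp).2
      (((Complex.differentiableOn_dslope hUp).2 hf).inv hφ0)
  have hbound : ∃ M : ℝ, ∀ z ∈ sᶜ, ‖h z‖ ≤ M := by
    have hcont : ContinuousAt h p := (hhd.differentiableAt hUp).continuousAt
    obtain ⟨r, hr, hball⟩ := Metric.eventually_nhds_iff_ball.1
      (hcont.norm.eventually_lt continuousAt_const (lt_add_one ‖h p‖))
    obtain ⟨ε, hε, hle⟩ :=
      exists_pos_le_norm_sub_of_injOn hUp (Metric.ball_mem_nhds p hr) hf hinj hd
    refine ⟨max (‖h p‖ + 1) (ε⁻¹ + ‖c‖ / r), fun z hz => ?_⟩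
    by_cases hzr : z ∈ Metric.ball p r
    · exact (hball z hzr).le.trans (le_max_left _ _)
    · refine le_trans ?_ (le_max_right _ _)
      have hzp : z ≠ p := by
        rintro rfl
        exact hzr (Metric.mem_ball_self hr)
      have hrz : r ≤ ‖z - p‖ := by simpa [dist_eq_norm] using hzr
      have hεz := hle z hz hzr
      rw [hhz z hz hzp]
      refine (norm_sub_le _ _).trans ?_
      rw [norm_inv, norm_div]
      gcongr
  obtain ⟨k, hk⟩ := exists_const_of_bounded_on_compl_finite hs h hhd hbound
  refine ⟨f p * k + 1, f p * (c - k * p) - p, k, c - k * p, ?_, fun z hz => ?_⟩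
  · convert hc0 using 1
    ring
  · rcases eq_or_ne z p with rfl | hzp
    · rw [eq_div_iff (by simpa using hc0)]
      ring
    · have h1 := sub_ne_zero.2 hzp
      have h2 := hne z hz hzp
      have h3 := hhz z hz hzp
      rw [hk z hz] at h3
      have h4 : (f z - f p) * (k * z + (c - k * p)) = z - p := by
        rw [h3]
        field_simp
        ring
      rw [eq_div_iff (right_ne_zero_of_mul (h4 ▸ h1))]
      linear_combination h4

theorem statement18 (f : ℂ → ℂ)
    (hmap : Set.MapsTo f U01 U01)
    (hhol : DifferentiableOn ℂ f U01)
    (hinj : Set.InjOn f U01) :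
    ∃ a b c d : ℂ, a * d - b * c ≠ 0 ∧
      ∀ z ∈ U01, f z = (a * z + b) / (c * z + d) := by
  have hU : U01 = ({0, 1} : Set ℂ)ᶜ := by
    ext z; simp [U01]
  rw [hU] at hhol hinj ⊢
  exact exists_linearFractional_of_injOn_compl_finite (Set.toFinite _) hhol hinj
end
end
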